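/- Let p be an odd prime and let P_p be the ((p-1)/2)-square matrix with entries P_p[α,i] = P(⟨αi/p⟩) where P(x)=x(1-x). If a vector M satisfies P_p · M = (1/6)·𝟏, then every entry of M equals 2p/(p²-1). -/

import Mathlib

/-- `P x = x(1-x)` -/
noncomputable def Ptor (x : ℝ) : ℝ := x * (1 - x)

/-- The matrix `P_p` with `(α,i)` entry `P(⟨αi/p⟩)`, `α,i ∈ {1,…,(p-1)/2}`. -/
noncomputable def Pmatrix (p : ℕ) : Matrix (Fin ((p - 1) / 2)) (Fin ((p - 1) / 2)) ℝ :=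
  fun α i => Ptor (Int.fract ((((α : ℕ) + 1) * ((i : ℕ) + 1) : ℝ) / p))

open Real Finset

/-- Fourier expansion of `P`. -/
lemma hasSum_P (y : ℝ) :
    HasSum (fun n : ℕ => (1 - cos (2 * π * n * y)) / (n : ℝ) ^ 2)
      (π ^ 2 * Ptor (Int.fract y)) := by
  have h1 := hasSum_one_div_nat_pow_mul_cos (k := 1) one_ne_zero
    (x := Int.fract y) ⟨Int.fract_nonneg y, (Int.fract_lt_one y).le⟩
  have h2 := hasSum_zeta_two
  have h3 := h2.sub h1
  have hB : (Polynomial.map (algebraMap ℚ ℝ) (Polynomial.bernoulli (2 * 1))).eval (Int.fract y)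
      = Int.fract y ^ 2 - Int.fract y + 1 / 6 := by
    norm_num [Polynomial.bernoulli, Finset.sum_range_succ, bernoulli_eq_bernoulli'_of_ne_one,
      bernoulli'_two, bernoulli_one, Polynomial.eval_monomial]
    ring
  rw [hB] at h3
  convert h3 using 1
  · rfl
  · funext n
    have : cos (2 * π * n * Int.fract y) = cos (2 * π * n * y) := by
      have e : 2 * π * n * Int.fract y = 2 * π * n * y - ((n * ⌊y⌋ : ℤ) : ℝ) * (2 * π) := by
        rw [Int.fract]; push_cast; ring
      rw [e, Real.cos_sub_int_mul_two_pi]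
    rw [this]
    ring
  · unfold Ptor
    norm_num [Nat.factorial]
    ring

lemma zero_of_max (D : ℕ → ℝ) (a : ℕ) (hmax : ∀ m, |D m| ≤ |D a|)
    (hs : HasSum (fun n : ℕ => D (n * a) / (n : ℝ) ^ 2) 0) : D a = 0 := by
  by_contra hne
  have hB : 0 < |D a| := abs_pos.mpr hne
  have hpi : π ^ 2 < 12 := by nlinarith [pi_lt_d2, pi_pos]
  have key : ∀ s : ℝ, |s| = 1 → s * D a = |D a| → False := by
    intro s hs1 hs2
    have h := (hasSum_zeta_two.mul_left |D a|).add (hs.mul_left s)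
    have h1 := le_hasSum h 1 (by
      intro j _
      have h3 : |s * D (j * a)| ≤ |D a| := by rw [abs_mul, hs1, one_mul]; exact hmax _
      have h4 := (abs_le.mp h3).1
      have : |D a| * (1 / (j : ℝ) ^ 2) + s * (D (j * a) / (j : ℝ) ^ 2)
        = (|D a| + s * D (j * a)) / (j : ℝ) ^ 2 := by ring
      rw [this]
      apply div_nonneg _ (by positivity)
      linarith)
    simp at h1
    nlinarith
  rcases abs_cases (D a) with ⟨h, _⟩ | ⟨h, _⟩
  · exact key 1 (by simp) (by rw [h]; ring)
  · exact key (-1) (by simp) (by rw [h]; ring)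

lemma hasSum_nondvd (p : ℕ) (hp : 0 < p) :
    HasSum (fun n : ℕ => (if p ∣ n then (0 : ℝ) else 1) / (n : ℝ) ^ 2)
      (π ^ 2 / 6 * (1 - 1 / (p : ℝ) ^ 2)) := by
  have h1 : HasSum (fun n : ℕ => (if p ∣ n then (1 : ℝ) else 0) / (n : ℝ) ^ 2)
      (1 / (p : ℝ) ^ 2 * (π ^ 2 / 6)) := by
    have hinj : Function.Injective (fun n : ℕ => p * n) :=
      fun a b h => Nat.eq_of_mul_eq_mul_left hp h
    rw [← hinj.hasSum_iff]
    · convert hasSum_zeta_two.mul_left (1 / (p : ℝ) ^ 2) using 1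
      · rfl
      funext n
      simp
      ring
    · intro x hx
      have : ¬ p ∣ x := fun ⟨k, hk⟩ => hx ⟨k, hk.symm⟩
      simp [this]
  convert hasSum_zeta_two.sub h1 using 1
  · rfl
  · funext n
    split_ifs <;> simp
  · ring

lemma cos_sum (p : ℕ) (hp : 0 < p) (k : ℤ) :
    ∑ m ∈ range p, cos (2 * π * m * k / p) = if (p : ℤ) ∣ k then (p : ℝ) else 0 := by
  have hp0 : (p : ℝ) ≠ 0 := by positivity
  have hpc : (p : ℂ) ≠ 0 := by exact_mod_cast hp.ne'
  split_ifs with h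
  · obtain ⟨q, rfl⟩ := h
    have : ∀ m ∈ range p, cos (2 * π * m * ((p * q : ℤ) : ℝ) / p) = 1 := by
      intro m _
      have e : 2 * π * m * ((p * q : ℤ) : ℝ) / p = ((m * q : ℤ) : ℝ) * (2 * π) := by
        push_cast; field_simp
      rw [e, Real.cos_int_mul_two_pi]
    rw [sum_congr rfl this]; simp
  · have hz := Complex.isPrimitiveRoot_exp p hp.ne'
    set z := Complex.exp (2 * π * Complex.I / p) with hzd
    have hw : z ^ k ≠ 1 := fun e => h ((hz.zpow_eq_one_iff_dvd k).mp e)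
    have hg : ∑ m ∈ range p, (z ^ k) ^ m = 0 := by
      have := mul_geom_sum (z ^ k) p
      have e : (z ^ k) ^ p = 1 := by
        rw [← zpow_natCast, ← zpow_mul, mul_comm, zpow_mul, zpow_natCast, hz.pow_eq_one, one_zpow]
      rw [e, sub_self] at this
      exact (mul_eq_zero.mp this).resolve_left (sub_ne_zero.mpr hw)
    have hr := congrArg Complex.re hg
    rw [Complex.re_sum] at hr
    simp only [Complex.zero_re] at hr
    rw [← hr]
    apply sum_congr rfl
    intro m _
    rw [hzd, ← Complex.exp_int_mul, ← Complex.exp_nat_mul]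
    have e : (m : ℂ) * (k * (2 * π * Complex.I / p)) =
      ((2 * π * m * k / p : ℝ) : ℂ) * Complex.I := by push_cast; ring
    rw [e, Complex.exp_ofReal_mul_I_re]

/-- The transform of `M`. -/
noncomputable def Htr (p : ℕ) (M : Fin ((p - 1) / 2) → ℝ) (m : ℕ) : ℝ :=
  ∑ i : Fin ((p - 1) / 2), (1 - cos (2 * π * m * ((i : ℕ) + 1 : ℤ) / p)) * M i

/-- The defect. -/
noncomputable def Dtr (p : ℕ) (M : Fin ((p - 1) / 2) → ℝ) (m : ℕ) : ℝ :=
  Htr p M m - (p : ℝ) ^ 2 / ((p : ℝ) ^ 2 - 1) * (if p ∣ m then 0 else 1)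

lemma Htr_add (p : ℕ) (hp : 0 < p) (M : Fin ((p - 1) / 2) → ℝ) (q r : ℕ) :
    Htr p M (p * q + r) = Htr p M r := by
  have hp0 : (p : ℝ) ≠ 0 := by positivity
  unfold Htr
  apply sum_congr rfl
  intro i _
  have e : 2 * π * ((p * q + r : ℕ) : ℝ) * ((i : ℕ) + 1 : ℤ) / p =
    2 * π * r * ((i : ℕ) + 1 : ℤ) / p + ((q * ((i : ℕ) + 1) : ℤ) : ℝ) * (2 * π) := by
    push_cast; field_simp; ring
  rw [e, Real.cos_add_int_mul_two_pi]

lemma Htr_sub (p : ℕ) (hp : 0 < p) (M : Fin ((p - 1) / 2) → ℝ) (r : ℕ) (hr : r ≤ p) :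
    Htr p M (p - r) = Htr p M r := by
  have hp0 : (p : ℝ) ≠ 0 := by positivity
  unfold Htr
  apply sum_congr rfl
  intro i _
  have e : 2 * π * ((p - r : ℕ) : ℝ) * ((i : ℕ) + 1 : ℤ) / p =
    ((((i : ℕ) + 1) : ℤ) : ℝ) * (2 * π) - 2 * π * r * ((i : ℕ) + 1 : ℤ) / p := by
    rw [Nat.cast_sub hr]
    push_cast; field_simp
  rw [e, Real.cos_int_mul_two_pi_sub]

lemma Dtr_reduce (p : ℕ) (hp : 0 < p) (hodd : Odd p) (M : Fin ((p - 1) / 2) → ℝ) (m : ℕ) :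
    ∃ a ∈ range ((p - 1) / 2 + 1), Dtr p M m = Dtr p M a := by
  have hm : p * (m / p) + m % p = m := Nat.div_add_mod m p
  have hlt : m % p < p := Nat.mod_lt _ hp
  have h1 : Dtr p M m = Dtr p M (m % p) := by
    unfold Dtr
    have : p ∣ m ↔ p ∣ m % p := (Nat.dvd_mod_iff dvd_rfl).symm
    simp only [this]
    congr 1
    conv_lhs => rw [← hm]
    exact Htr_add p hp M _ _
  obtain ⟨k, hk⟩ := hodd
  by_cases hc : m % p ≤ (p - 1) / 2
  · exact ⟨m % p, by simp; omega, h1⟩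
  · refine ⟨p - m % p, by simp; omega, ?_⟩
    rw [h1]
    unfold Dtr
    have : p ∣ p - m % p ↔ p ∣ m % p := by
      constructor
      · intro h
        have := Nat.dvd_sub (dvd_refl p) h
        rwa [Nat.sub_sub_self hlt.le] at this
      · intro h
        exact Nat.dvd_sub (dvd_refl p) h
    simp only [this]
    rw [Htr_sub p hp M _ hlt.le]

lemma Dtr_hasSum (p : ℕ) (hp : p.Prime) (M : Fin ((p - 1) / 2) → ℝ)
    (hM : (Pmatrix p).mulVec M = fun _ => 1 / 6) (a : Fin ((p - 1) / 2)) :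
    HasSum (fun n : ℕ => Dtr p M (n * (a + 1)) / (n : ℝ) ^ 2) 0 := by
  have hp1 : (1 : ℝ) < p := by exact_mod_cast hp.one_lt
  have hp0 : (p : ℝ) ≠ 0 := by positivity
  have hp2 : (p : ℝ) ^ 2 - 1 ≠ 0 := by nlinarith
  have h1 := hasSum_sum (s := univ) (fun (i : Fin ((p - 1) / 2)) (_ : i ∈ univ) =>
    (hasSum_P ((((a : ℕ) + 1) * ((i : ℕ) + 1) : ℝ) / p)).mul_right (M i))
  have h2 := h1.sub ((hasSum_nondvd p hp.pos).mul_left ((p : ℝ) ^ 2 / ((p : ℝ) ^ 2 - 1)))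
  have hMa := congrFun hM a
  simp only [Matrix.mulVec, dotProduct, Pmatrix] at hMa
  convert h2 using 1
  · rfl
  · funext n
    have hd : p ∣ n * ((a : ℕ) + 1) ↔ p ∣ n := by
      rw [hp.dvd_mul]
      refine or_iff_left fun h => ?_
      have := Nat.le_of_dvd (by omega) h
      have := a.2
      omega
    unfold Dtr Htr
    simp only [hd]
    rw [sub_div, sum_div]
    congr 1
    · apply sum_congr rfl
      intro i _
      have e : 2 * π * ((n * ((a : ℕ) + 1) : ℕ) : ℝ) * ((i : ℕ) + 1 : ℤ) / p =
        2 * π * n * ((((a : ℕ) + 1) * ((i : ℕ) + 1) : ℝ) / p) := by push_cast; ring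
      rw [e]; ring
    · ring
  · simp only [mul_assoc]
    rw [← mul_sum, hMa]
    field_simp
    ring

lemma Dtr_zero (p : ℕ) (hp : p.Prime) (hodd : Odd p) (M : Fin ((p - 1) / 2) → ℝ)
    (hM : (Pmatrix p).mulVec M = fun _ => 1 / 6) (m : ℕ) : Dtr p M m = 0 := by
  obtain ⟨a, ha, hmax⟩ := exists_max_image (range ((p - 1) / 2 + 1)) (fun a => |Dtr p M a|)
    ⟨0, by simp⟩
  have hmax' : ∀ m, |Dtr p M m| ≤ |Dtr p M a| := by
    intro m
    obtain ⟨b, hb, e⟩ := Dtr_reduce p hp.pos hodd M m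
    rw [e]; exact hmax b hb
  have h0 : Dtr p M a = 0 := by
    rcases a with _ | a
    · simp [Dtr, Htr]
    · have ha' : a < (p - 1) / 2 := by simpa using ha
      exact zero_of_max _ _ hmax' (Dtr_hasSum p hp M hM ⟨a, ha'⟩)
  have := hmax' m
  rw [h0, abs_zero] at this
  exact abs_nonpos_iff.mp this

theorem solution_unique (p : ℕ) (hp : p.Prime) (hodd : Odd p)
    (M : Fin ((p - 1) / 2) → ℝ)
    (hM : (Pmatrix p).mulVec M = fun _ => 1 / 6) :
    ∀ i, M i = 2 * (p : ℝ) / ((p : ℝ) ^ 2 - 1) := by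
  intro j
  have hp1 : (1 : ℝ) < p := by exact_mod_cast hp.one_lt
  have hp0 : (p : ℝ) ≠ 0 := by positivity
  have hp2 : (p : ℝ) ^ 2 - 1 ≠ 0 := by nlinarith
  set J : ℤ := (j : ℕ) + 1 with hJ
  have hnd : ∀ k : ℤ, 0 < |k| → |k| < p → ¬ (p : ℤ) ∣ k := by
    intro k h1 h2 h
    have := Int.le_of_dvd h1 ((dvd_abs _ _).mpr h)
    omega
  have hj := j.2
  have hcJ : ∑ m ∈ range p, cos (2 * π * m * J / p) = 0 := by
    rw [cos_sum p hp.pos, if_neg]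
    apply hnd <;> rw [abs_of_pos (by omega)] <;> omega
  -- left side
  have hL : ∑ m ∈ range p, Htr p M m * cos (2 * π * m * J / p) = - (p / 2 * M j) := by
    have inner : ∀ i : Fin ((p - 1) / 2),
        ∑ m ∈ range p, (1 - cos (2 * π * m * ((i : ℕ) + 1 : ℤ) / p)) * M i
          * cos (2 * π * m * J / p) = if i = j then - (p / 2 * M j) else 0 := by
      intro i
      have hi := i.2
      set I : ℤ := (i : ℕ) + 1 with hI
      have e : ∀ m ∈ range p, (1 - cos (2 * π * m * I / p)) * M i * cos (2 * π * m * J / p)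
          = M i * cos (2 * π * m * J / p) - M i / 2 * cos (2 * π * m * ((I + J : ℤ) : ℝ) / p)
            - M i / 2 * cos (2 * π * m * ((I - J : ℤ) : ℝ) / p) := by
        intro m _
        have e1 : 2 * π * m * ((I + J : ℤ) : ℝ) / p
          = 2 * π * m * I / p + 2 * π * m * J / p := by push_cast; ring
        have e2 : 2 * π * m * ((I - J : ℤ) : ℝ) / p
          = 2 * π * m * I / p - 2 * π * m * J / p := by push_cast; ring
        rw [e1, e2, cos_add, cos_sub]; ring
      rw [sum_congr rfl e, sum_sub_distrib, sum_sub_distrib, ← mul_sum, ← mul_sum, ← mul_sum,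
        hcJ, cos_sum p hp.pos, cos_sum p hp.pos, if_neg]
      · by_cases hij : i = j
        · subst hij
          simp [hI, hJ]; ring
        · have hne : (i : ℕ) ≠ j := fun h => hij (Fin.ext h)
          rw [if_neg, if_neg hij]
          · ring
          · apply hnd
            · apply abs_pos.mpr; omega
            · rw [abs_lt]; constructor <;> omega
      · apply hnd <;> rw [abs_of_pos (by omega)] <;> omega
    unfold Htr
    simp only [sum_mul]
    rw [sum_comm, sum_congr rfl (fun i _ => inner i)]
    simp
  have hR : ∑ m ∈ range p, Htr p M m * cos (2 * π * m * J / p)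
      = - ((p : ℝ) ^ 2 / ((p : ℝ) ^ 2 - 1)) := by
    have e : ∀ m ∈ range p, Htr p M m * cos (2 * π * m * J / p) =
        (p : ℝ) ^ 2 / ((p : ℝ) ^ 2 - 1) * cos (2 * π * m * J / p)
        - if m = 0 then (p : ℝ) ^ 2 / ((p : ℝ) ^ 2 - 1) else 0 := by
      intro m hm
      have hz := Dtr_zero p hp hodd M hM m
      unfold Dtr at hz
      rw [sub_eq_zero.mp hz]
      by_cases h0 : m = 0
      · subst h0; simp
      · have : ¬ p ∣ m := fun h => by
          have := Nat.le_of_dvd (by omega) h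
          have := mem_range.mp hm
          omega
        simp [this, h0]
    rw [sum_congr rfl e, sum_sub_distrib, ← mul_sum, hcJ]
    simp [hp.pos.ne']
  rw [hL] at hR
  have h3 : (p : ℝ) / 2 * M j = (p : ℝ) ^ 2 / ((p : ℝ) ^ 2 - 1) := by linarith
  field_simp at h3 ⊢
  linarith
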